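/- (Rains' Lemma) Assume |P| ≥ 3 and let L ⊆ V^P be a two-dimensional isotropic subspace such that for every p ∈ P the Cartesian projection V^P → V^{{p}} maps L onto V^{{p}}. Then for every p ∈ P the group A(L)_p ⊆ SO(3) is contained in the octahedral group. -/

import Mathlib

/- Common framework: binary stabilizer codes, local unitary/SO(3) automorphism groups. -/

noncomputable section
open scoped Matrix Real ComplexConjugate
open scoped Classical

namespace Stab

/-- The one-qubit phase space `V = 𝔽₂ ⊕ 𝔽₂`, with first coordinate the `z`-component
and second coordinate the `x`-component. -/
abbrev V : Type := ZMod 2 × ZMod 2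

/-- The symplectic form on `V`. -/
def omegaV (u v : V) : ZMod 2 := u.1 * v.2 + u.2 * v.1

/-- The phase space `V^P` over a set of qubits `P`. -/
abbrev QV (P : Type) := P → V

variable {P : Type} [Fintype P] [DecidableEq P]

/-- The direct-sum symplectic form on `V^P`. -/
def omega (u v : QV P) : ZMod 2 := ∑ p, omegaV (u p) (v p)

/-- A subspace `L ⊆ V^P` is isotropic if `ω` vanishes identically on `L × L`. -/
def Isotropic (L : Submodule (ZMod 2) (QV P)) : Prop := ∀ u ∈ L, ∀ v ∈ L, omega u v = 0

/-- Support of a vector of `V^P`. -/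
def supp (v : QV P) : Set P := {p | v p ≠ 0}

/-- The basis vector `z_p`. -/
def zvec (p : P) : QV P := Pi.single p ((1 : ZMod 2), (0 : ZMod 2))

/-- The basis vector `x_p`. -/
def xvec (p : P) : QV P := Pi.single p ((0 : ZMod 2), (1 : ZMod 2))

/-- Restriction (coordinate projection) of a vector to a subset `S ⊆ P`. -/
def restrTo (S : Set P) (v : QV P) : QV P := fun p => if p ∈ S then v p else 0

/-- The coordinate subspace `V^S ⊆ V^P`. -/
def coordSub (S : Set P) : Submodule (ZMod 2) (QV P) where
  carrier := {v | ∀ p ∉ S, v p = 0}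
  add_mem' := by intro a b ha hb p hp; simp [Pi.add_apply, ha p hp, hb p hp]
  zero_mem' := by intro p _; rfl
  smul_mem' := by intro c a ha p hp; simp [Pi.smul_apply, ha p hp]

/-- `L_S := L ∩ V^S`. -/
def LS (L : Submodule (ZMod 2) (QV P)) (S : Set P) : Submodule (ZMod 2) (QV P) :=
  L ⊓ coordSub S

/-- `L` splits as a direct factor on `S`, i.e. `L = L_S × L_{P∖S}`. -/
def SplitsOn (L : Submodule (ZMod 2) (QV P)) (S : Set P) : Prop :=
  ∀ v ∈ L, restrTo S v ∈ L

/-- `L` splits off a zero factor: on some nonempty `S ⊆ P` all vectors of `L` vanish. -/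
def HasZeroFactor (L : Submodule (ZMod 2) (QV P)) : Prop :=
  ∃ S : Set P, S.Nonempty ∧ ∀ v ∈ L, ∀ p ∈ S, v p = 0

/-- The qubit `p` is trivial: `L` splits off a one-dimensional factor on `{p}`. -/
def TrivialQubit (L : Submodule (ZMod 2) (QV P)) (p : P) : Prop :=
  SplitsOn L {p} ∧ ∃ v ∈ L, v ≠ 0 ∧ supp v ⊆ {p}

/-- `L` splits off a trivial factor. -/
def HasTrivialFactor (L : Submodule (ZMod 2) (QV P)) : Prop :=
  ∃ p : P, TrivialQubit L p

/-- `L` splits off a Bell Lagrangian: an indecomposable Lagrangian direct factor on a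
two-element set of qubits (all of whose nonzero vectors have full support `{p, q}`). -/
def HasBellFactor (L : Submodule (ZMod 2) (QV P)) : Prop :=
  ∃ p q : P, p ≠ q ∧ SplitsOn L {p, q} ∧
    ∃ v ∈ L, ∃ w ∈ L, v ≠ w ∧ supp v = {p, q} ∧ supp w = {p, q} ∧ supp (v + w) = {p, q}

/-- The factor `L_S` (for `S` in a partition) is indecomposable. -/
def IndecompWithin (L : Submodule (ZMod 2) (QV P)) (S : Set P) : Prop :=
  ∀ T ⊆ S, SplitsOn L T → T = ∅ ∨ T = S

/-! ### The Hilbert space, Pauli operators and stabilizer codes -/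

/-- The state space `ℋ^{⊗P} = (ℂ²)^{⊗P}`, realised concretely as functions on
computational basis labels. -/
abbrev HP (P : Type) := (P → Fin 2) → ℂ

/-- Operators on `ℋ^{⊗P}` as matrices. -/
abbrev MatP (P : Type) := Matrix (P → Fin 2) (P → Fin 2) ℂ

/-- The tensor (local) operator `⊗_{p} g_p` on `ℋ^{⊗P}`. -/
def locOp (g : P → Matrix (Fin 2) (Fin 2) ℂ) : MatP P :=
  Matrix.of fun u w => ∏ p, g p (u p) (w p)

def sigmaX : Matrix (Fin 2) (Fin 2) ℂ := !![0, 1; 1, 0]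
def sigmaY : Matrix (Fin 2) (Fin 2) ℂ := !![0, -Complex.I; Complex.I, 0]
def sigmaZ : Matrix (Fin 2) (Fin 2) ℂ := !![1, 0; 0, -1]

/-- The one-qubit Pauli operator `Z^a X^b` attached to `(a, b) ∈ V`. -/
def pauliMat (v : V) : Matrix (Fin 2) (Fin 2) ℂ := sigmaZ ^ (v.1 : ZMod 2).val * sigmaX ^ (v.2 : ZMod 2).val

/-- The Pauli (Weyl) operator attached to `v ∈ V^P`. -/
def Wop (v : QV P) : MatP P := locOp fun p => pauliMat (v p)

/-- A group-homomorphic section `σ` over `L` of the projection from the Pauli group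
`Ṽ^P` onto `V^P`: each value `σ(v)` is a unitary scalar multiple of the Pauli operator
`W(v)`, and `σ` is multiplicative on `L`. -/
structure PauliSection (L : Submodule (ZMod 2) (QV P)) where
  toFun : QV P → MatP P
  scalar : ∀ v : QV P, ∃ c : ℂ, toFun v = c • Wop v
  unitary : ∀ v : QV P, toFun v ∈ Matrix.unitaryGroup (P → Fin 2) ℂ
  mul_of_mem : ∀ u ∈ L, ∀ v ∈ L, toFun (u + v) = toFun u * toFun v
  map_zero : toFun 0 = 1

/-- The stabilizer code `C(L, σ)`: the common fixed-point space of the stabilizer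
group `σ(L)`. -/
def code (L : Submodule (ZMod 2) (QV P)) (σ : PauliSection L) : Submodule ℂ (HP P) where
  carrier := {ψ | ∀ v ∈ L, σ.toFun v *ᵥ ψ = ψ}
  add_mem' := by intro a b ha hb v hv; rw [Matrix.mulVec_add, ha v hv, hb v hv]
  zero_mem' := by intro v hv; simp
  smul_mem' := by intro c a ha v hv; rw [Matrix.mulVec_smul, ha v hv]

/-- The standard section: `σ(v) = W(v)` on `L`. -/
def StandardOn (L : Submodule (ZMod 2) (QV P)) (σ : PauliSection L) : Prop :=
  ∀ v ∈ L, σ.toFun v = Wop v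

/-! ### `SO(3)`, rotations, and the automorphism group of a code -/

/-- `3×3` real matrices. -/
abbrev Rot : Type := Matrix (Fin 3) (Fin 3) ℝ

/-- `SO(3)` as a set of `3×3` real matrices. -/
def SO3 : Set Rot := {A | A * Aᵀ = 1 ∧ A.det = 1}

/-- The ordered Pauli basis (x, y, z) of traceless Hermitian `2×2` matrices. -/
def pauliBasis : Fin 3 → Matrix (Fin 2) (Fin 2) ℂ := ![sigmaX, sigmaY, sigmaZ]

/-- The image of a unitary `u ∈ U(2)` in `SO(3)` under the adjoint action on traceless
Hermitian operators (the identification `U(2)/S¹ = SO(3)`):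
`u σ_j u† = Σ_i (adjRot u)_{ij} σ_i`. -/
def adjRot (u : Matrix (Fin 2) (Fin 2) ℂ) : Rot :=
  Matrix.of fun i j =>
    (1 / 2 : ℝ) * ((pauliBasis i * u * pauliBasis j * u.conjTranspose).trace).re

/-- Rotation about the `x`-axis by angle `θ`. -/
def rotX (θ : ℝ) : Rot := !![1, 0, 0; 0, Real.cos θ, -Real.sin θ; 0, Real.sin θ, Real.cos θ]

/-- Rotation about the `y`-axis by angle `θ`. -/
def rotY (θ : ℝ) : Rot := !![Real.cos θ, 0, Real.sin θ; 0, 1, 0; -Real.sin θ, 0, Real.cos θ]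

/-- Rotation about the `z`-axis by angle `θ`. -/
def rotZ (θ : ℝ) : Rot := !![Real.cos θ, -Real.sin θ, 0; Real.sin θ, Real.cos θ, 0; 0, 0, 1]

/-- The circle group `C_x ⊆ SO(3)` of rotations about the `x`-axis. -/
def Cx : Set Rot := Set.range rotX

/-- The circle group `C_y ⊆ SO(3)` of rotations about the `y`-axis. -/
def Cy : Set Rot := Set.range rotY

/-- The circle group `C_z ⊆ SO(3)` of rotations about the `z`-axis. -/
def Cz : Set Rot := Set.range rotZ

/-- The octahedral group: the subgroup of `SO(3)` generated by the rotations by a right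
angle about the three coordinate axes. -/
def octahedral : Set Rot :=
  (Submonoid.closure {rotX (π / 2), rotY (π / 2), rotZ (π / 2)} : Submonoid Rot)

/-- The infinite dihedral group `D_x ⊆ SO(3)`. -/
def Dx : Set Rot := (Submonoid.closure (Cx ∪ {rotZ π}) : Submonoid Rot)

/-- The infinite dihedral group `D_y ⊆ SO(3)`. -/
def Dy : Set Rot := (Submonoid.closure (Cy ∪ {rotZ π}) : Submonoid Rot)

/-- The infinite dihedral group `D_z ⊆ SO(3)`. -/
def Dz : Set Rot := (Submonoid.closure (Cz ∪ {rotX π}) : Submonoid Rot)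

/-- The automorphism group `A(L, σ) ⊆ SO(3)^P` of the stabilizer code `C(L, σ)`:
all families of rotations admitting a local unitary lift mapping the code into itself. -/
def autSet (L : Submodule (ZMod 2) (QV P)) (σ : PauliSection L) : Set (P → Rot) :=
  {g | ∃ u : P → Matrix (Fin 2) (Fin 2) ℂ,
        (∀ p, u p ∈ Matrix.unitaryGroup (Fin 2) ℂ) ∧
        (∀ p, adjRot (u p) = g p) ∧
        ∀ ψ ∈ code L σ, locOp u *ᵥ ψ ∈ code L σ}

/-- The automorphism group `A(L, σ)_p` at the qubit `p`. -/
def autSetAt (L : Submodule (ZMod 2) (QV P)) (σ : PauliSection L) (p : P) : Set Rot :=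
  (fun g => g p) '' autSet L σ

/-- The normal subgroup `Z(L, σ)` of automorphisms acting by a scalar on the code. -/
def zSet (L : Submodule (ZMod 2) (QV P)) (σ : PauliSection L) : Set (P → Rot) :=
  {g | ∃ u : P → Matrix (Fin 2) (Fin 2) ℂ,
        (∀ p, u p ∈ Matrix.unitaryGroup (Fin 2) ℂ) ∧
        (∀ p, adjRot (u p) = g p) ∧
        ∃ c : ℂ, ∀ ψ ∈ code L σ, locOp u *ᵥ ψ = c • ψ}

/-! ### Restriction to subsets of qubits -/

/-- Restriction of a phase-space vector to the qubits of `S`. -/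
def resQV (S : Set P) (v : QV P) : QV ↥S := fun s => v s

/-- Restriction as a linear map. -/
def resLin (S : Set P) : QV P →ₗ[ZMod 2] QV ↥S where
  toFun := resQV S
  map_add' := by intros; rfl
  map_smul' := by intros; rfl

/-- `L_S`, regarded as a subspace of `V^S`. -/
def LSsub (L : Submodule (ZMod 2) (QV P)) (S : Set P) : Submodule (ZMod 2) (QV ↥S) :=
  Submodule.map (resLin S) (LS L S)

/-- The extension `M ⊗ 1` to `ℋ^{⊗P}` of an operator `M` on `ℋ^{⊗S}`. -/
def extendOp (S : Set P) (M : Matrix (↥S → Fin 2) (↥S → Fin 2) ℂ) : MatP P :=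
  Matrix.of fun u w =>
    if ∀ p ∉ S, u p = w p then M (fun s => u s) (fun s => w s) else 0

/-- `σ'` is the restriction `σ|_{L_S}` of the section `σ` to `L_S`. -/
def RestrictedSection (L : Submodule (ZMod 2) (QV P)) (σ : PauliSection L) (S : Set P)
    (σ' : PauliSection (LSsub L S)) : Prop :=
  ∀ v ∈ LS L S, extendOp S (σ'.toFun (resQV S v)) = σ.toFun v

/-! ### Contiguity, protected and gauge qubits, and normal forms -/

/-- Two qubits are contiguous if they are equal or `L` contains a vector supported
exactly on the pair. -/
def Contig (L : Submodule (ZMod 2) (QV P)) (p q : P) : Prop :=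
  p = q ∨ ∃ v ∈ L, supp v = ({p, q} : Set P)

/-- The contiguity class of a qubit. -/
def contigClass (L : Submodule (ZMod 2) (QV P)) (p : P) : Set P := {q | Contig L p q}

/-- The qubit `p` is protected: the projection `L → V^{{p}}` is surjective. -/
def IsProtected (L : Submodule (ZMod 2) (QV P)) (p : P) : Prop :=
  ∀ w : V, ∃ v ∈ L, v p = w

/-- The qubit `p` is of gauge type: the projection `L → V^{{p}}` has a line as image. -/
def IsGauge (L : Submodule (ZMod 2) (QV P)) (p : P) : Prop :=
  ¬ IsProtected L p ∧ ∃ v ∈ L, v p ≠ 0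

/-- The subspace `⟨z_a + z_b : a ≠ b ∈ S⟩`. -/
def zspan (S : Set P) : Submodule (ZMod 2) (QV P) :=
  Submodule.span (ZMod 2) {w | ∃ a ∈ S, ∃ b ∈ S, a ≠ b ∧ w = zvec a + zvec b}

/-- The vector `Σ_{s ∈ S} x_s`. -/
def xsumOn (S : Set P) : QV P := S.indicator fun _ => ((0 : ZMod 2), (1 : ZMod 2))

/-- Normal form of `L` (conclusion of the normalisation lemma): every contiguity class `S`
carries either `⟨z_a + z_b⟩` or `⟨z_a + z_b⟩ + ⟨Σ_{s∈S} x_s⟩`. -/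
def NormalForm (L : Submodule (ZMod 2) (QV P)) : Prop :=
  ∀ p : P,
    LS L (contigClass L p) = zspan (contigClass L p) ∨
    LS L (contigClass L p) =
      zspan (contigClass L p) ⊔ Submodule.span (ZMod 2) {xsumOn (contigClass L p)}

/-- The pair `(L, σ)` is normalised. -/
def Normalised (L : Submodule (ZMod 2) (QV P)) (σ : PauliSection L) : Prop :=
  NormalForm L ∧
  (∀ p : P, IsGauge L p → contigClass L p = {p} → ∀ v ∈ L, (v p).2 = 0) ∧
  (∀ p : P, IsProtected L p → contigClass L p = {p} →
    connectedComponentIn (autSetAt L σ p) 1 ⊆ Cz) ∧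
  (∀ p : P, IsProtected L p → contigClass L p ≠ {p} →
    LS L (contigClass L p) = zspan (contigClass L p) →
    ∃ v ∈ L, ∀ s ∈ contigClass L p, v s = ((0 : ZMod 2), (1 : ZMod 2))) ∧
  (∀ p q : P, p ≠ q → Contig L p q →
    σ.toFun (zvec p + zvec q) = Wop (zvec p + zvec q))

/-- A local symplectic family of automorphisms of `V`. -/
def IsLocalSymp (f : P → (V ≃ₗ[ZMod 2] V)) : Prop :=
  ∀ (p : P) (u v : V), omegaV (f p u) (f p v) = omegaV u v

/-- The image of `L` under a local (symplectic) transformation. -/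
def mapL (L : Submodule (ZMod 2) (QV P)) (f : P → (V ≃ₗ[ZMod 2] V)) :
    Submodule (ZMod 2) (QV P) :=
  Submodule.map (LinearEquiv.piCongrRight f : QV P ≃ₗ[ZMod 2] QV P).toLinearMap L

/-! ### Abstract group structures carried by subsets of a monoid -/

/-- The set `s` carries the structure of a solvable group. -/
structure SolvableGroupStructure (M : Type) [Monoid M] (s : Set M) where
  G : Type
  [grp : Group G]
  solv : IsSolvable G
  f : G → M
  inj : Function.Injective f
  map_mul : ∀ a b : G, f (a * b) = f a * f b
  range_eq : Set.range f = s

/-- The quotient of the group (carried by) `A` by the normal subgroup (carried by) `Z`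
is a compact solvable topological (Lie) group. -/
structure CompactSolvableQuotientStructure (M : Type) [Monoid M] [TopologicalSpace M]
    (A Z : Set M) where
  G : Type
  [grp : Group G]
  [top : TopologicalSpace G]
  [tgrp : IsTopologicalGroup G]
  cpt : CompactSpace G
  solv : IsSolvable G
  φ : M → G
  cont : ContinuousOn φ A
  map_mul' : ∀ a ∈ A, ∀ b ∈ A, φ (a * b) = φ a * φ b
  surj : ∀ y : G, ∃ a ∈ A, φ a = y
  ker : ∀ a ∈ A, (φ a = 1 ↔ a ∈ Z)

/-! ### Logical qubits and transversally realisable gates -/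

/-- The standard hermitian inner product on a finite-dimensional function space. -/
def innerF {ι : Type} [Fintype ι] (ψ φ : ι → ℂ) : ℂ := ∑ i, (starRingEnd ℂ) (ψ i) * φ i

/-- `e` is a unitary identification of the code space with a space of logical qubits. -/
def IsUnitaryEquiv (L : Submodule (ZMod 2) (QV P)) (σ : PauliSection L) {d : ℕ}
    (e : ↥(code L σ) ≃ₗ[ℂ] HP (Fin d)) : Prop :=
  ∀ ψ φ : ↥(code L σ),
    innerF (e ψ) (e φ) = innerF (ψ : HP P) (φ : HP P)

/-- The operator acting as `w` on the logical qubit `k` and trivially elsewhere. -/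
def oneQubitOp (d : ℕ) (k : Fin d) (w : Matrix (Fin 2) (Fin 2) ℂ) : MatP (Fin d) :=
  locOp fun j => if j = k then w else 1

/-- The set of rotations in `SO(3)` induced, via the identification `e`, on a fixed
logical qubit `k` by (exactly realised) transversal gates, i.e. by elements of `A(L, σ)`. -/
def logicalSet (L : Submodule (ZMod 2) (QV P)) (σ : PauliSection L) {d : ℕ}
    (e : ↥(code L σ) ≃ₗ[ℂ] HP (Fin d)) (k : Fin d) : Set Rot :=
  {A | ∃ w ∈ Matrix.unitaryGroup (Fin 2) ℂ, adjRot w = A ∧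
        ∃ u : P → Matrix (Fin 2) (Fin 2) ℂ,
          (∀ p, u p ∈ Matrix.unitaryGroup (Fin 2) ℂ) ∧
          ∀ φ : HP (Fin d),
            locOp u *ᵥ ((e.symm φ : HP P)) = ((e.symm (oneQubitOp d k w *ᵥ φ) : HP P))}

/-! ### Reed–Muller codes -/

/-- The qubit set `P = 𝔽₂^m ∖ {0}`. -/
abbrev RMQubits (m : ℕ) := {s : Fin m → ZMod 2 // s ≠ 0}

/-- Polynomial functions on `𝔽₂^m` of degree at most `r` with zero constant term. -/
def RMspan (r m : ℕ) : Submodule (ZMod 2) ((Fin m → ZMod 2) → ZMod 2) :=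
  Submodule.span (ZMod 2)
    {f | ∃ I : Finset (Fin m), I.Nonempty ∧ I.card ≤ r ∧ f = fun s => ∏ i ∈ I, s i}

/-- The shortened Reed–Muller code `R_*(r, m) ⊆ 𝔽₂^P`. -/
def RMstar (r m : ℕ) : Submodule (ZMod 2) (RMQubits m → ZMod 2) :=
  Submodule.map (LinearMap.funLeft (ZMod 2) (ZMod 2) Subtype.val) (RMspan r m)

/-- The `z`-part of a phase-space vector. -/
def zPart {P : Type} : QV P →ₗ[ZMod 2] (P → ZMod 2) where
  toFun v := fun p => (v p).1
  map_add' := by intros; rfl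
  map_smul' := by intros; rfl

/-- The `x`-part of a phase-space vector. -/
def xPart {P : Type} : QV P →ₗ[ZMod 2] (P → ZMod 2) where
  toFun v := fun p => (v p).2
  map_add' := by intros; rfl
  map_smul' := by intros; rfl

/-- The Calderbank–Shor–Steane isotropic subspace built from the shortened Reed–Muller
codes `R_*(m−2, m)` (in the `z`-coordinates) and `R_*(1, m)` (in the `x`-coordinates). -/
def cssL (m : ℕ) : Submodule (ZMod 2) (QV (RMQubits m)) :=
  Submodule.comap zPart (RMstar (m - 2) m) ⊓ Submodule.comap xPart (RMstar 1 m)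

/-- The stabilizer state `|0⟩_S ⊗ |0⟩_T + |0⟩_S ⊗ |1⟩_T + |1⟩_S ⊗ |0⟩_T − |1⟩_S ⊗ |1⟩_T`
(with `T = Sᶜ`), written in the computational basis. -/
def bellLike (S : Set P) (p q : P) : HP P := fun u =>
  if (∀ a ∈ S, u a = u p) ∧ (∀ a ∈ Sᶜ, u a = u q) then
    ((-1 : ℂ)) ^ ((u p : Fin 2).val * (u q : Fin 2).val) else 0


/-! ### Tensor products of local operators -/

theorem locOp_mul (g h : P → Matrix (Fin 2) (Fin 2) ℂ) :
    locOp g * locOp h = locOp fun p => g p * h p := by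
  ext u w
  simp only [locOp, Matrix.mul_apply, Matrix.of_apply, ← Finset.prod_mul_distrib]
  exact (Fintype.prod_sum fun p k => g p (u p) k * h p k (w p)).symm

theorem locOp_one {P : Type} [Fintype P] :
    locOp (fun _ : P => (1 : Matrix (Fin 2) (Fin 2) ℂ)) = 1 := by
  ext u w
  simp only [locOp, Matrix.of_apply]
  by_cases h : u = w
  · subst h
    simp
  · obtain ⟨p, hp⟩ := Function.ne_iff.mp h
    rw [Matrix.one_apply_ne h]
    exact Finset.prod_eq_zero (Finset.mem_univ p) (Matrix.one_apply_ne hp)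

theorem locOp_conjTranspose {P : Type} [Fintype P] (g : P → Matrix (Fin 2) (Fin 2) ℂ) :
    (locOp g)ᴴ = locOp fun p => (g p)ᴴ := by
  ext u w
  simp [locOp, Matrix.conjTranspose_apply]

theorem trace_locOp (g : P → Matrix (Fin 2) (Fin 2) ℂ) :
    (locOp g).trace = ∏ p, (g p).trace := by
  simp only [locOp, Matrix.trace, Matrix.diag_apply, Matrix.of_apply]
  exact (Fintype.prod_sum fun p k => g p k k).symm

/-! ### Trace orthogonality of the Pauli matrices -/

theorem forall_V {q : V → Prop} (h00 : q (0, 0)) (h01 : q (0, 1)) (h10 : q (1, 0))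
    (h11 : q (1, 1)) (v : V) : q v := by
  obtain ⟨a, b⟩ := v
  fin_cases a <;> fin_cases b <;> assumption

theorem pauliMat_zero_zero : pauliMat (0, 0) = 1 := by
  simp [pauliMat]

theorem pauliMat_zero_one : pauliMat (0, 1) = sigmaX := by
  simp [pauliMat, ZMod.val_one]

theorem pauliMat_one_zero : pauliMat (1, 0) = sigmaZ := by
  simp [pauliMat, ZMod.val_one]

theorem pauliMat_one_one : pauliMat (1, 1) = Complex.I • sigmaY := by
  ext i j
  fin_cases i <;> fin_cases j <;>
    simp [pauliMat, ZMod.val_one, sigmaX, sigmaY, sigmaZ, Matrix.mul_apply]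

theorem trace_pauliMat_mul_of_ne {a b : V} (h : a ≠ b) :
    ((pauliMat a)ᴴ * pauliMat b).trace = 0 := by
  revert h
  induction a using forall_V <;> induction b using forall_V <;>
    simp [pauliMat_zero_zero, pauliMat_zero_one, pauliMat_one_zero, pauliMat_one_one,
      sigmaX, sigmaY, sigmaZ, Matrix.trace_fin_two, Matrix.mul_apply]

theorem trace_pauliMat_mul_self (a : V) : ((pauliMat a)ᴴ * pauliMat a).trace = 2 := by
  induction a using forall_V <;>
    norm_num [pauliMat_zero_zero, pauliMat_zero_one, pauliMat_one_zero, pauliMat_one_one,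
      sigmaX, sigmaY, sigmaZ, Matrix.trace_fin_two, Matrix.mul_apply]

theorem eq_zero_of_trace_pauliMat_mul (M : Matrix (Fin 2) (Fin 2) ℂ)
    (h : ∀ a : V, ((pauliMat a)ᴴ * M).trace = 0) : M = 0 := by
  have h00 := h (0, 0)
  have h01 := h (0, 1)
  have h10 := h (1, 0)
  have h11 := h (1, 1)
  simp [pauliMat_zero_zero, pauliMat_zero_one, pauliMat_one_zero, pauliMat_one_one,
      sigmaX, sigmaY, sigmaZ, Matrix.trace_fin_two, Matrix.mul_apply] at h00 h01 h10 h11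
  ext i j
  fin_cases i <;> fin_cases j <;> simp <;> grind

/-! ### The stabilizer sum of a code -/

/-- The sum of the stabilizer group, a positive multiple of the projector onto the code. -/
def stabSum (L : Submodule (ZMod 2) (QV P)) (σ : PauliSection L) : MatP P :=
  ∑ v : L, σ.toFun v

section StabSum

variable (L : Submodule (ZMod 2) (QV P)) (σ : PauliSection L)

theorem toFun_mul_stabSum {v : QV P} (hv : v ∈ L) :
    σ.toFun v * stabSum L σ = stabSum L σ := by
  rw [stabSum, Finset.mul_sum]
  refine Fintype.sum_equiv (Equiv.addLeft (⟨v, hv⟩ : L)) _ _ fun w => ?_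
  exact (σ.mul_of_mem v hv w w.2).symm

theorem stabSum_mul_of_fixed {M : MatP P} (h : ∀ v ∈ L, σ.toFun v * M = M) :
    stabSum L σ * M = (Fintype.card L : ℂ) • M := by
  rw [stabSum, Finset.sum_mul, Finset.sum_congr rfl fun v _ => h v.1 v.2]
  simp [Nat.cast_smul_eq_nsmul]

theorem conjTranspose_toFun {v : QV P} (hv : v ∈ L) : (σ.toFun v)ᴴ = σ.toFun v := by
  have hvv : v + v = 0 := funext fun p => CharTwo.add_self_eq_zero (v p)
  have h1 : σ.toFun v * σ.toFun v = 1 := by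
    rw [← σ.mul_of_mem v hv v hv, hvv, σ.map_zero]
  have h2 : (σ.toFun v)ᴴ * σ.toFun v = 1 := (Matrix.mem_unitaryGroup_iff').1 (σ.unitary v)
  exact left_inv_eq_right_inv h2 h1

theorem conjTranspose_stabSum : (stabSum L σ)ᴴ = stabSum L σ := by
  rw [stabSum, Matrix.conjTranspose_sum]
  exact Finset.sum_congr rfl fun v _ => conjTranspose_toFun L σ v.2

theorem stabSum_mulVec_mem_code (ψ : HP P) : stabSum L σ *ᵥ ψ ∈ code L σ := by
  intro v hv
  rw [Matrix.mulVec_mulVec, toFun_mul_stabSum L σ hv]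

open scoped ComplexOrder in
theorem conj_stabSum_of_preserves_code {U : MatP P} (hU : Uᴴ * U = 1)
    (h : ∀ ψ ∈ code L σ, U *ᵥ ψ ∈ code L σ) :
    U * stabSum L σ * Uᴴ = stabSum L σ := by
  set S := stabSum L σ with hS
  set N : ℂ := (Fintype.card L : ℂ) with hN
  have hSS : S * S = N • S := stabSum_mul_of_fixed L σ fun v hv => toFun_mul_stabSum L σ hv
  have hfix : ∀ v ∈ L, σ.toFun v * (U * S) = U * S := by
    intro v hv
    refine Matrix.ext_of_mulVec_single fun i => ?_
    have := h _ (stabSum_mulVec_mem_code L σ (Pi.single i 1)) v hv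
    simpa only [Matrix.mulVec_mulVec, Matrix.mul_assoc] using this
  have hSUS : S * (U * S) = N • (U * S) := stabSum_mul_of_fixed L σ hfix
  set M := U * S * Uᴴ with hM
  have hMh : Mᴴ = M := by
    simp only [hM, Matrix.conjTranspose_mul, Matrix.conjTranspose_conjTranspose, hS,
      conjTranspose_stabSum, Matrix.mul_assoc]
  have hSh : Sᴴ = S := conjTranspose_stabSum L σ
  have hSM : S * M = N • M := by
    rw [hM, ← Matrix.mul_assoc, hSUS, Matrix.smul_mul]
  have hMS : M * S = N • M := by
    have := congrArg Matrix.conjTranspose hSM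
    simpa [Matrix.conjTranspose_mul, Matrix.conjTranspose_smul, hMh, hSh, hN] using this
  have hMM : M * M = N • M := by
    calc M * M = U * S * (Uᴴ * U) * S * Uᴴ := by simp only [hM, Matrix.mul_assoc]
      _ = U * (S * S) * Uᴴ := by rw [hU, Matrix.mul_one, Matrix.mul_assoc U S S]
      _ = N • M := by rw [hSS, Matrix.mul_smul, Matrix.smul_mul]
  have htr : M.trace = S.trace := by
    rw [hM, Matrix.trace_mul_comm, ← Matrix.mul_assoc, hU, Matrix.one_mul]
  have hsq : (M - S)ᴴ * (M - S) = N • (S - M) := by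
    rw [Matrix.conjTranspose_sub, hMh, hSh, Matrix.sub_mul, Matrix.mul_sub, Matrix.mul_sub,
      hMM, hMS, hSM, hSS, smul_sub]
    abel
  have hz : ((M - S)ᴴ * (M - S)).trace = 0 := by
    rw [hsq, Matrix.trace_smul, Matrix.trace_sub, htr, sub_self, smul_zero]
  exact sub_eq_zero.1 (Matrix.trace_conjTranspose_mul_self_eq_zero_iff.1 hz)

theorem exists_toFun_eq_smul (v : QV P) : ∃ c : ℂ, c ≠ 0 ∧ σ.toFun v = c • Wop v := by
  obtain ⟨c, hc⟩ := σ.scalar v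
  refine ⟨c, ?_, hc⟩
  rintro rfl
  have h := (Matrix.mem_unitaryGroup_iff').1 (σ.unitary v)
  rw [hc, zero_smul, mul_zero] at h
  exact zero_ne_one h

end StabSum

/-! ### Local unitaries preserving the code permute Pauli matrices up to scalars -/

theorem trace_mul_trace_eq_zero (L : Submodule (ZMod 2) (QV P)) (σ : PauliSection L)
    (hinj : ∀ s : P, ∀ v ∈ L, ∀ w ∈ L, v s = w s → v = w)
    {u : P → Matrix (Fin 2) (Fin 2) ℂ} (hu : ∀ p, (u p)ᴴ * u p = 1)
    (h : ∀ ψ ∈ code L σ, locOp u *ᵥ ψ ∈ code L σ)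
    {p q s : P} (hpq : p ≠ q) (hsp : s ≠ p) (hsq : s ≠ q) {w : QV P} (hw : w ∈ L) {a b : V}
    (hab : ∀ v ∈ L, v p = a → v q ≠ b) :
    ((pauliMat a)ᴴ * (u p * pauliMat (w p) * (u p)ᴴ)).trace *
      ((pauliMat b)ᴴ * (u q * pauliMat (w q) * (u q)ᴴ)).trace = 0 := by
  have hU : (locOp u)ᴴ * locOp u = 1 := by
    rw [locOp_conjTranspose, locOp_mul, ← locOp_one]
    exact congrArg locOp (funext hu)
  have hS := conj_stabSum_of_preserves_code L σ hU h
  choose c hc0 hc using exists_toFun_eq_smul L σ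
  let x : P → Matrix (Fin 2) (Fin 2) ℂ := fun r =>
    if r = p then (pauliMat a)ᴴ else if r = q then (pauliMat b)ᴴ
      else u r * (pauliMat (w r))ᴴ * (u r)ᴴ
  have hxp : x p = (pauliMat a)ᴴ := by simp [x]
  have hxq : x q = (pauliMat b)ᴴ := by simp [x, hpq.symm]
  have hxr : ∀ r, r ≠ p → r ≠ q → x r = u r * (pauliMat (w r))ᴴ * (u r)ᴴ := by
    intro r h1 h2
    simp [x, h1, h2]
  have hcancel : ∀ r, r ≠ p → r ≠ q → ∀ y : V,
      (x r * (u r * pauliMat y * (u r)ᴴ)).trace = ((pauliMat (w r))ᴴ * pauliMat y).trace := by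
    intro r h1 h2 y
    calc (x r * (u r * pauliMat y * (u r)ᴴ)).trace
        = (u r * ((pauliMat (w r))ᴴ * ((u r)ᴴ * u r) * pauliMat y * (u r)ᴴ)).trace := by
          rw [hxr r h1 h2]; simp only [Matrix.mul_assoc]
      _ = ((pauliMat (w r))ᴴ * ((u r)ᴴ * u r) * pauliMat y * ((u r)ᴴ * u r)).trace := by
          rw [Matrix.trace_mul_comm]; simp only [Matrix.mul_assoc]
      _ = _ := by rw [hu, Matrix.mul_one, Matrix.mul_one]
  have key : (locOp x * (locOp u * stabSum L σ * (locOp u)ᴴ)).trace =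
      (locOp x * stabSum L σ).trace := by rw [hS]
  have hleft : (locOp x * (locOp u * stabSum L σ * (locOp u)ᴴ)).trace =
      ∑ v : L, c v * ∏ r, (x r * (u r * pauliMat (v.1 r) * (u r)ᴴ)).trace := by
    simp only [stabSum, Finset.mul_sum, Finset.sum_mul, Matrix.trace_sum]
    refine Finset.sum_congr rfl fun v _ => ?_
    rw [hc, Wop, Matrix.mul_smul, Matrix.smul_mul, Matrix.mul_smul, Matrix.trace_smul,
      locOp_conjTranspose, locOp_mul, locOp_mul, locOp_mul, trace_locOp, smul_eq_mul]
  have hright : (locOp x * stabSum L σ).trace =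
      ∑ v : L, c v * ∏ r, (x r * pauliMat (v.1 r)).trace := by
    simp only [stabSum, Finset.mul_sum, Matrix.trace_sum]
    refine Finset.sum_congr rfl fun v _ => ?_
    rw [hc, Wop, Matrix.mul_smul, Matrix.trace_smul, locOp_mul, trace_locOp, smul_eq_mul]
  have hright0 : ∑ v : L, c v * ∏ r, (x r * pauliMat (v.1 r)).trace = 0 := by
    refine Finset.sum_eq_zero fun v _ => mul_eq_zero_of_right _ ?_
    by_cases hvp : v.1 p = a
    · refine Finset.prod_eq_zero (Finset.mem_univ q) ?_
      rw [hxq]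
      exact trace_pauliMat_mul_of_ne (hab v v.2 hvp).symm
    · refine Finset.prod_eq_zero (Finset.mem_univ p) ?_
      rw [hxp]
      exact trace_pauliMat_mul_of_ne (Ne.symm hvp)
  rw [hleft, hright, hright0, Fintype.sum_eq_single (⟨w, hw⟩ : L)] at key
  · have hprod := (mul_eq_zero.1 key).resolve_left (hc0 w)
    obtain ⟨r, -, hr⟩ := Finset.prod_eq_zero_iff.1 hprod
    by_cases hrp : r = p
    · subst hrp
      rw [hxp] at hr
      exact mul_eq_zero_of_left hr _
    by_cases hrq : r = q
    · subst hrq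
      rw [hxq] at hr
      exact mul_eq_zero_of_right _ hr
    rw [hcancel r hrp hrq, trace_pauliMat_mul_self] at hr
    exact absurd hr two_ne_zero
  · intro v hv
    refine mul_eq_zero_of_right _ (Finset.prod_eq_zero (Finset.mem_univ s) ?_)
    rw [hcancel s hsp hsq]
    refine trace_pauliMat_mul_of_ne fun hs => hv ?_
    exact Subtype.ext (hinj s v v.2 w hw hs.symm)

theorem exists_trace_eq_zero_of_ne (L : Submodule (ZMod 2) (QV P)) (σ : PauliSection L)
    (hP : 3 ≤ Fintype.card P) (hsurj : ∀ p : P, IsProtected L p)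
    (hinj : ∀ s : P, ∀ v ∈ L, ∀ w ∈ L, v s = w s → v = w)
    {u : P → Matrix (Fin 2) (Fin 2) ℂ} (hu : ∀ p, (u p)ᴴ * u p = 1)
    (h : ∀ ψ ∈ code L σ, locOp u *ᵥ ψ ∈ code L σ) (p : P) (y : V) :
    ∃ d : V, ∀ a, a ≠ d → ((pauliMat a)ᴴ * (u p * pauliMat y * (u p)ᴴ)).trace = 0 := by
  obtain ⟨w, hw, rfl⟩ := hsurj p y
  obtain ⟨q, hqp⟩ := Fintype.exists_ne_of_one_lt_card (by omega) p
  obtain ⟨s, hs⟩ : ∃ s, s ∉ ({p, q} : Finset P) := by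
    by_contra! hall
    have h1 := Finset.card_le_card (fun r _ => hall r : (Finset.univ : Finset P) ⊆ {p, q})
    have h2 := Finset.card_le_two (a := p) (b := q)
    rw [Finset.card_univ] at h1
    omega
  simp only [Finset.mem_insert, Finset.mem_singleton, not_or] at hs
  obtain ⟨b, hb⟩ : ∃ b, ((pauliMat b)ᴴ * (u q * pauliMat (w q) * (u q)ᴴ)).trace ≠ 0 := by
    by_contra! hall
    have h0 := eq_zero_of_trace_pauliMat_mul _ hall
    have h1 : pauliMat (w q) = (u q)ᴴ * (u q * pauliMat (w q) * (u q)ᴴ) * u q := by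
      calc pauliMat (w q) = ((u q)ᴴ * u q) * pauliMat (w q) * ((u q)ᴴ * u q) := by
            rw [hu, Matrix.one_mul, Matrix.mul_one]
        _ = _ := by simp only [Matrix.mul_assoc]
    have h2 := trace_pauliMat_mul_self (w q)
    rw [h1, h0] at h2
    simp at h2
  obtain ⟨v, hv, hvb⟩ := hsurj q b
  refine ⟨v p, fun a ha => ?_⟩
  refine (mul_eq_zero.1 (trace_mul_trace_eq_zero L σ hinj hu h hqp.symm hs.1 hs.2 hw
    fun v' hv' hp' hq' => ha ?_)).resolve_right hb
  rw [← hp', hinj q v' hv' v hv (hq'.trans hvb.symm)]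

/-! ### Rotations induced by unitaries -/

theorem adjRot_smul {c : ℂ} (hc : starRingEnd ℂ c * c = 1) (u : Matrix (Fin 2) (Fin 2) ℂ) :
    adjRot (c • u) = adjRot u := by
  ext i j
  simp only [adjRot, Matrix.of_apply, Matrix.conjTranspose_smul, Matrix.mul_smul,
    Matrix.smul_mul, smul_smul, ← starRingEnd_apply, hc, one_smul]

theorem adjRot_quaternion (w x y z : ℝ) :
    adjRot !![⟨w, x⟩, ⟨y, z⟩; ⟨-y, z⟩, ⟨w, -x⟩] =
      !![w ^ 2 - x ^ 2 - y ^ 2 + z ^ 2, 2 * (w * x + y * z), 2 * (x * z - w * y);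
         2 * (y * z - w * x), w ^ 2 - x ^ 2 + y ^ 2 - z ^ 2, 2 * (w * z + x * y);
         2 * (w * y + x * z), 2 * (x * y - w * z), w ^ 2 + x ^ 2 - y ^ 2 - z ^ 2] := by
  ext i j
  fin_cases i <;> fin_cases j <;>
    simp [adjRot, pauliBasis, sigmaX, sigmaY, sigmaZ, Matrix.trace_fin_two,
      Matrix.mul_apply] <;> ring

theorem adjRot_mem_SO3_of_det_eq_one {u : Matrix (Fin 2) (Fin 2) ℂ} (hu : u * uᴴ = 1)
    (hdet : u.det = 1) : adjRot u ∈ SO3 := by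
  have hadj : uᴴ = u.adjugate := by
    refine (left_inv_eq_right_inv ?_ hu).symm
    rw [Matrix.adjugate_mul, hdet, one_smul]
  have h1 : u 1 1 = starRingEnd ℂ (u 0 0) := by
    have := congrFun (congrFun hadj 0) 0
    simpa [Matrix.adjugate_fin_two] using this.symm
  have h2 : u 1 0 = -starRingEnd ℂ (u 0 1) := by
    have := congrFun (congrFun hadj 1) 0
    simp [Matrix.adjugate_fin_two] at this
    simp [this]
  have hform : u = !![⟨(u 0 0).re, (u 0 0).im⟩, ⟨(u 0 1).re, (u 0 1).im⟩;
      ⟨-(u 0 1).re, (u 0 1).im⟩, ⟨(u 0 0).re, -(u 0 0).im⟩] := by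
    ext i j
    fin_cases i <;> fin_cases j <;> simp [h1, h2, Complex.ext_iff]
  have hn : (u 0 0).re ^ 2 + (u 0 0).im ^ 2 + (u 0 1).re ^ 2 + (u 0 1).im ^ 2 = 1 := by
    have := congrArg Complex.re hdet
    simp [Matrix.det_fin_two, h1, h2] at this
    linarith
  generalize (u 0 0).re = w at hform hn
  generalize (u 0 0).im = x at hform hn
  generalize (u 0 1).re = y at hform hn
  generalize (u 0 1).im = z at hform hn
  rw [hform, adjRot_quaternion]
  have hn2 : (w ^ 2 + x ^ 2 + y ^ 2 + z ^ 2) ^ 2 = 1 := by rw [hn, one_pow]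
  have hn3 : (w ^ 2 + x ^ 2 + y ^ 2 + z ^ 2) ^ 3 = 1 := by rw [hn, one_pow]
  constructor
  · ext i j
    fin_cases i <;> fin_cases j <;>
      simp [Matrix.mul_apply, Fin.sum_univ_three] <;>
      first | linear_combination hn2 | ring
  · rw [Matrix.det_fin_three]
    simp
    linear_combination hn3

theorem adjRot_mem_SO3 {u : Matrix (Fin 2) (Fin 2) ℂ} (hu : u ∈ Matrix.unitaryGroup (Fin 2) ℂ) :
    adjRot u ∈ SO3 := by
  have hu1 : u * uᴴ = 1 := Matrix.mem_unitaryGroup_iff.1 hu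
  obtain ⟨c, hc⟩ := IsAlgClosed.exists_pow_nat_eq u.det two_pos
  have hcc : starRingEnd ℂ c * c = 1 := by
    have h1 := congrArg Matrix.det hu1
    rw [Matrix.det_mul, Matrix.det_conjTranspose, Matrix.det_one, ← hc, ← starRingEnd_apply,
      Complex.mul_conj, Complex.normSq_eq_norm_sq, norm_pow] at h1
    norm_cast at h1
    have h2 : ‖c‖ = 1 := by
      rw [← pow_mul] at h1
      exact (pow_eq_one_iff_of_nonneg (norm_nonneg c) (by norm_num)).1 h1
    rw [mul_comm, Complex.mul_conj, Complex.normSq_eq_norm_sq, h2]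
    simp
  obtain ⟨v, rfl⟩ : ∃ v, u = c • v := by
    refine ⟨starRingEnd ℂ c • u, ?_⟩
    rw [smul_smul, mul_comm, hcc, one_smul]
  have hv : v * vᴴ = 1 := by
    rwa [Matrix.conjTranspose_smul, Matrix.smul_mul, Matrix.mul_smul, smul_smul,
      ← starRingEnd_apply, mul_comm, hcc, one_smul] at hu1
  have hdet : v.det = 1 := by
    have hc0 : c ^ 2 ≠ 0 := pow_ne_zero _ (right_ne_zero_of_mul_eq_one hcc)
    rw [Matrix.det_smul, Fintype.card_fin] at hc
    exact mul_left_cancel₀ hc0 (by rw [← hc, mul_one])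
  rw [adjRot_smul hcc]
  exact adjRot_mem_SO3_of_det_eq_one hv hdet

theorem exists_adjRot_eq_zero {u : Matrix (Fin 2) (Fin 2) ℂ}
    (h : ∀ y : V, ∃ d : V, ∀ a, a ≠ d →
      ((pauliMat a)ᴴ * (u * pauliMat y * uᴴ)).trace = 0) (j : Fin 3) :
    ∃ k, ∀ i, i ≠ k → adjRot u i j = 0 := by
  let e : Fin 3 → V := ![(0, 1), (1, 1), (1, 0)]
  have he : Function.Injective e := by decide
  have hσ : ∀ i, ∃ c : ℂ, pauliBasis i = c • pauliMat (e i) := by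
    intro i
    fin_cases i
    · exact ⟨1, by simp [e, pauliBasis, pauliMat_zero_one]⟩
    · exact ⟨-Complex.I, by simp [e, pauliBasis, pauliMat_one_one, smul_smul]⟩
    · exact ⟨1, by simp [e, pauliBasis, pauliMat_one_zero]⟩
  have hσh : ∀ i, (pauliBasis i)ᴴ = pauliBasis i := by
    intro i
    ext k l
    fin_cases i <;> fin_cases k <;> fin_cases l <;>
      simp [pauliBasis, sigmaX, sigmaY, sigmaZ]
  obtain ⟨d, hd⟩ := h (e j)
  obtain ⟨cj, hcj⟩ := hσ j
  have hz : ∀ i, e i ≠ d → adjRot u i j = 0 := by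
    intro i hi
    obtain ⟨ci, hci⟩ := hσ i
    have : (pauliBasis i * u * pauliBasis j * uᴴ).trace = 0 := by
      rw [← hσh i, hci, hcj]
      simp only [Matrix.conjTranspose_smul, Matrix.smul_mul, Matrix.mul_smul, Matrix.trace_smul]
      have := hd (e i) hi
      simp only [← Matrix.mul_assoc] at this
      rw [this, smul_zero, smul_zero]
    simp [adjRot, this]
  by_cases hex : ∃ k, e k = d
  · obtain ⟨k, rfl⟩ := hex
    exact ⟨k, fun i hi => hz i (he.ne hi)⟩
  · push Not at hex
    exact ⟨0, fun i _ => hz i (hex i)⟩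

/-- The rotations by right angles about the `x`-, `y`- and `z`-axis, as integral matrices. -/
def quarterTurn : Fin 3 → Matrix (Fin 3) (Fin 3) ℤ :=
  ![!![1, 0, 0; 0, 0, -1; 0, 1, 0], !![0, 0, 1; 0, 1, 0; -1, 0, 0],
    !![0, -1, 0; 1, 0, 0; 0, 0, 1]]

theorem quarterTurn_map_mem_octahedral (i : Fin 3) :
    (quarterTurn i).map (Int.cast : ℤ → ℝ) ∈ octahedral := by
  refine Submonoid.subset_closure ?_
  fin_cases i
  · refine Or.inl ?_
    ext k l
    fin_cases k <;> fin_cases l <;> simp [quarterTurn, rotX]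
  · refine Or.inr (Or.inl ?_)
    ext k l
    fin_cases k <;> fin_cases l <;> simp [quarterTurn, rotY]
  · refine Or.inr (Or.inr ?_)
    ext k l
    fin_cases k <;> fin_cases l <;> simp [quarterTurn, rotZ]

/-- The matrix whose `j`-th column is `s j` times the `k j`-th standard basis vector. -/
def signedMonomial (k : Fin 3 → Fin 3) (s : Fin 3 → ℤˣ) : Matrix (Fin 3) (Fin 3) ℤ :=
  Matrix.of fun i j => if i = k j then (s j : ℤ) else 0

/-- Exponents `(a, b)` such that `quarterTurn 2 ^ a * quarterTurn 1 ^ b` maps the first standard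
basis vector to `s` times the `k`-th one. -/
def eulerExponents (k : Fin 3) (s : ℤˣ) : ℕ × ℕ :=
  if s = 1 then ![(0, 0), (1, 0), (0, 3)] k else ![(0, 2), (3, 0), (0, 1)] k

theorem exists_eulerAngles_of_signedMonomial :
    ∀ k0 k1 k2 : Fin 3, ∀ s0 s1 s2 : ℤˣ,
      (signedMonomial ![k0, k1, k2] ![s0, s1, s2]).det = 1 →
      ∃ c : Fin 4, signedMonomial ![k0, k1, k2] ![s0, s1, s2] =
        quarterTurn 2 ^ (eulerExponents k0 s0).1 * quarterTurn 1 ^ (eulerExponents k0 s0).2 *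
          quarterTurn 0 ^ c.val := by
  simp only [Matrix.det_fin_three]
  decide +kernel

theorem mem_octahedral_of_monomial {A : Rot} (hA : A ∈ SO3)
    (h : ∀ j, ∃ k, ∀ i, i ≠ k → A i j = 0) : A ∈ octahedral := by
  obtain ⟨horth, hdet⟩ := hA
  choose k hk using h
  have hsign : ∀ j, ∃ s : ℤˣ, A (k j) j = (s : ℤ) := by
    intro j
    have hj : (Aᵀ * A) j j = (1 : Rot) j j := by rw [mul_eq_one_comm.1 horth]
    rw [Matrix.mul_apply, Fintype.sum_eq_single (k j) fun i hi => by simp [hk j i hi]] at hj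
    simp only [Matrix.transpose_apply, Matrix.one_apply_eq] at hj
    rcases mul_self_eq_one_iff.1 hj with h1 | h1
    · exact ⟨1, by simp [h1]⟩
    · exact ⟨-1, by simp [h1]⟩
  choose s hs using hsign
  have hAs : A = (signedMonomial k s).map (Int.cast : ℤ → ℝ) := by
    ext i j
    by_cases hi : i = k j
    · subst hi
      simp [signedMonomial, hs]
    · simp [signedMonomial, hi, hk j i hi]
  have hdet' : (signedMonomial k s).det = 1 := by
    have h1 : (((signedMonomial k s).det : ℤ) : ℝ) = 1 := by
      rw [← hdet, hAs]
      exact (Int.castRingHom ℝ).map_det _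
    exact_mod_cast h1
  have hks : signedMonomial k s = signedMonomial ![k 0, k 1, k 2] ![s 0, s 1, s 2] := by
    congr 1 <;> ext j <;> fin_cases j <;> rfl
  rw [hks] at hdet' hAs
  obtain ⟨c, hc⟩ := exists_eulerAngles_of_signedMonomial _ _ _ _ _ _ hdet'
  let f := (Int.castRingHom ℝ).mapMatrix (m := Fin 3)
  have hf : ∀ i, f (quarterTurn i) ∈
      Submonoid.closure {rotX (π / 2), rotY (π / 2), rotZ (π / 2)} :=
    quarterTurn_map_mem_octahedral
  have hAf : A = f (quarterTurn 2) ^ (eulerExponents (k 0) (s 0)).1 *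
      f (quarterTurn 1) ^ (eulerExponents (k 0) (s 0)).2 * f (quarterTurn 0) ^ c.val := by
    rw [hAs, hc, ← map_pow, ← map_pow, ← map_pow, ← map_mul, ← map_mul]
    rfl
  rw [hAf]
  exact mul_mem (mul_mem (pow_mem (hf 2) _) (pow_mem (hf 1) _)) (pow_mem (hf 0) _)

/-- **Rains' Lemma.** Assume `|P| ≥ 3` and let `L ⊆ V^P` be a two-dimensional isotropic
subspace such that for every `p ∈ P` the Cartesian projection `V^P → V^{{p}}` maps `L`
onto `V^{{p}}`. Then for every `p ∈ P` the group `A(L)_p ⊆ SO(3)` is contained in the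
octahedral group. -/
theorem rains_lemma {P : Type} [Fintype P] [DecidableEq P] (hP : 3 ≤ Fintype.card P)
    (L : Submodule (ZMod 2) (QV P)) (hL : Isotropic L)
    (hdim : Module.finrank (ZMod 2) ↥L = 2)
    (hsurj : ∀ p : P, IsProtected L p)
    (σ : PauliSection L) (p : P) :
    autSetAt L σ p ⊆ octahedral := by
  rintro _ ⟨g, ⟨u, hu, hg, hcode⟩, rfl⟩
  have hu' : ∀ p, (u p)ᴴ * u p = 1 := fun p => Matrix.mem_unitaryGroup_iff'.1 (hu p)
  have hinj : ∀ s : P, ∀ v ∈ L, ∀ w ∈ L, v s = w s → v = w := by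
    intro s v hv w hw hvw
    let f : L →ₗ[ZMod 2] V := LinearMap.proj s ∘ₗ L.subtype
    have hf : Function.Surjective f := fun y => by
      obtain ⟨v, hv, hy⟩ := hsurj s y
      exact ⟨⟨v, hv⟩, hy⟩
    have hrank : Module.finrank (ZMod 2) L = Module.finrank (ZMod 2) V := by
      rw [hdim, Module.finrank_prod, Module.finrank_self]
    have := (LinearMap.injective_iff_surjective_of_finrank_eq_finrank hrank).2 hf
    exact congrArg Subtype.val (@this ⟨v, hv⟩ ⟨w, hw⟩ hvw)
  change g p ∈ octahedral
  rw [← hg p]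
  exact mem_octahedral_of_monomial (adjRot_mem_SO3 (hu p))
    (exists_adjRot_eq_zero (exists_trace_eq_zero_of_ne L σ hP hsurj hinj hu' hcode p))

end Stab
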